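/- Let c ≥ 0 and ρ > 0. The metric Lie algebra (heis₃, g_ρ^c) is a nilsoliton: setting K := 2ρ²(ρ+c)/(ρ+2c)³, the Ricci endomorphism satisfies ric(heis₃, g_ρ^c) = −3K·id + D, where D := 2K·δ and δ is the derivation of heis₃ given by δ(e₀) = e₀, δ(f₀) = f₀, δ(Z) = 2Z. In particular there exist λ < 0 and a derivation D of heis₃ with ric = λ·id + D. -/

import Mathlib

open Matrix

/-- The three-dimensional Heisenberg bracket on `ℝ³` in the basis `(e₀, f₀, Z)`:
the only nonzero basis bracket is `[e₀,f₀] = Z`, with `Z` central. -/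
def brkH (x y : Fin 3 → ℝ) : Fin 3 → ℝ :=
  fun k => if (k:ℕ) = 2 then x 0 * y 1 - x 1 * y 0 else 0

/-- The Gram matrix of the inner product `g_ρ^c` on `heis₃` in the basis `(e₀,f₀,Z)`:
`diag((ρ+2c)/(4ρ²), (ρ+2c)/(4ρ²), (ρ+c)/(4ρ²(ρ+2c)))`. -/
noncomputable def GramH (c ρ : ℝ) : Matrix (Fin 3) (Fin 3) ℝ :=
  Matrix.diagonal ![(ρ+2*c)/(4*ρ^2), (ρ+2*c)/(4*ρ^2), (ρ+c)/(4*ρ^2*(ρ+2*c))]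

/-- The matrix (in the basis `(e₀,f₀,Z)`) of the adjoint operator `ad(x) = [x,·]`
of `heis₃`. -/
noncomputable def adH (x : Fin 3 → ℝ) : Matrix (Fin 3) (Fin 3) ℝ :=
  Matrix.of fun i j => brkH x (Pi.single j 1) i

/-- The inner product on `heis₃` with Gram matrix `diag(a, a, b)`, in coordinates. -/
lemma dotProduct_diagonal_mulVec (a b : ℝ) (x y : Fin 3 → ℝ) :
    x ⬝ᵥ (Matrix.diagonal ![a, a, b]).mulVec y
      = a * (x 0 * y 0) + a * (x 1 * y 1) + b * (x 2 * y 2) := by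
  simp [dotProduct, Matrix.mulVec_diagonal, Fin.sum_univ_three]
  ring

lemma dotProduct_diagonal_mulVec_single (a b : ℝ) (x : Fin 3 → ℝ) (i : Fin 3) :
    x ⬝ᵥ (Matrix.diagonal ![a, a, b]).mulVec (Pi.single i 1) = x i * ![a, a, b] i := by
  fin_cases i <;> simp [mul_comm]

lemma brkH_zero (x y : Fin 3 → ℝ) : brkH x y 0 = 0 := by simp [brkH]

lemma brkH_one (x y : Fin 3 → ℝ) : brkH x y 1 = 0 := by simp [brkH]

lemma brkH_two (x y : Fin 3 → ℝ) : brkH x y 2 = x 0 * y 1 - x 1 * y 0 := by simp [brkH]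

lemma trace_adH (x : Fin 3 → ℝ) : (adH x).trace = 0 := by
  simp [Matrix.trace, adH, Fin.sum_univ_three, brkH_zero, brkH_one, brkH_two]

lemma trace_adH_mul_adH (x y : Fin 3 → ℝ) : (adH x * adH y).trace = 0 := by
  simp [Matrix.trace, Matrix.mul_apply, adH, Fin.sum_univ_three, brkH_zero, brkH_one, brkH_two]

lemma adH_zero : adH 0 = 0 := by
  ext i j
  simp [adH, brkH]

/-- A vector orthogonal to every basis vector vanishes. -/
lemma eq_zero_of_dotProduct_diagonal_mulVec {a b : ℝ} (ha : 0 < a) (hb : 0 < b)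
    {x : Fin 3 → ℝ} (h : ∀ y, x ⬝ᵥ (Matrix.diagonal ![a, a, b]).mulVec y = 0) : x = 0 := by
  ext i
  have hi := h (Pi.single i 1)
  rw [dotProduct_diagonal_mulVec_single] at hi
  fin_cases i <;> simpa [ha.ne', hb.ne'] using hi

/-- A bilinear form determines the operator representing it. -/
lemma eq_of_mulVec_dotProduct_diagonal_mulVec {a b : ℝ} (ha : 0 < a) (hb : 0 < b)
    {A B : Matrix (Fin 3) (Fin 3) ℝ}
    (h : ∀ x y, A.mulVec x ⬝ᵥ (Matrix.diagonal ![a, a, b]).mulVec y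
      = B.mulVec x ⬝ᵥ (Matrix.diagonal ![a, a, b]).mulVec y) : A = B := by
  refine Matrix.ext_of_mulVec_single fun i => sub_eq_zero.mp ?_
  refine eq_zero_of_dotProduct_diagonal_mulVec ha hb fun y => ?_
  rw [sub_dotProduct, h, sub_self]

/-- The dual completeness relation `∑ᵢ Lᵢ Lᵢᵀ = diag(a, a, b)⁻¹` of an orthonormal basis. -/
lemma sum_mul_of_orthonormal {a b : ℝ} {L : Fin 3 → (Fin 3 → ℝ)}
    (hL : ∀ i j, L i ⬝ᵥ (Matrix.diagonal ![a, a, b]).mulVec (L j) = if i = j then (1 : ℝ) else 0)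
    (j k : Fin 3) :
    ![a, a, b] j * ∑ i, L i j * L i k = if j = k then 1 else 0 := by
  have h : Matrix.of L * (Matrix.diagonal ![a, a, b] * (Matrix.of L)ᵀ) = 1 := by
    ext i j
    rw [Matrix.one_apply, ← hL i j]
    rw [Matrix.mul_apply]
    simp only [Matrix.diagonal_mul, dotProduct, Matrix.mulVec_diagonal, Matrix.of_apply,
      Matrix.transpose_apply]
  have h' := mul_eq_one_comm.mp h
  rw [← Matrix.one_apply, ← h', Matrix.mul_apply, Finset.mul_sum]
  simp [Matrix.diagonal_mul, mul_assoc]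

/-- The part of the Ricci form of `heis₃` not involving the Killing form or the mean curvature
vector, for the inner product `diag(a, a, b)`. -/
lemma curvature_form_eq {a b : ℝ} (ha : 0 < a) {L : Fin 3 → (Fin 3 → ℝ)}
    (hL : ∀ i j, L i ⬝ᵥ (Matrix.diagonal ![a, a, b]).mulVec (L j) = if i = j then (1 : ℝ) else 0)
    (x y : Fin 3 → ℝ) :
    -(1/2) * (∑ i, (brkH x (L i)) ⬝ᵥ (Matrix.diagonal ![a, a, b]).mulVec (brkH y (L i)))
      + (1/4) * (∑ i, ∑ j,
          ((brkH (L i) (L j)) ⬝ᵥ (Matrix.diagonal ![a, a, b]).mulVec x)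
            * ((brkH (L i) (L j)) ⬝ᵥ (Matrix.diagonal ![a, a, b]).mulVec y))
      = (Matrix.diagonal ![-(b / (2 * a^2)), -(b / (2 * a^2)), b / (2 * a^2)]).mulVec x
          ⬝ᵥ (Matrix.diagonal ![a, a, b]).mulVec y := by
  have h00 : ∑ i, L i 0 * L i 0 = 1 / a := by
    rw [eq_div_iff ha.ne', mul_comm]
    simpa using sum_mul_of_orthonormal hL 0 0
  have h11 : ∑ i, L i 1 * L i 1 = 1 / a := by
    rw [eq_div_iff ha.ne', mul_comm]
    simpa using sum_mul_of_orthonormal hL 1 1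
  have h01 : ∑ i, L i 0 * L i 1 = 0 := by
    simpa [ha.ne'] using sum_mul_of_orthonormal hL 0 1
  have hfst : ∑ i, (brkH x (L i)) ⬝ᵥ (Matrix.diagonal ![a, a, b]).mulVec (brkH y (L i))
      = b * (x 0 * y 0 * (∑ i, L i 1 * L i 1) + x 1 * y 1 * (∑ i, L i 0 * L i 0)
          - (x 0 * y 1 + x 1 * y 0) * ∑ i, L i 0 * L i 1) := by
    simp only [dotProduct_diagonal_mulVec, brkH_zero, brkH_one, brkH_two, Fin.sum_univ_three]
    ring
  have hsnd : ∑ i, ∑ j, ((brkH (L i) (L j)) ⬝ᵥ (Matrix.diagonal ![a, a, b]).mulVec x)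
            * ((brkH (L i) (L j)) ⬝ᵥ (Matrix.diagonal ![a, a, b]).mulVec y)
      = 2 * b^2 * (x 2 * y 2) * ((∑ i, L i 0 * L i 0) * (∑ i, L i 1 * L i 1)
          - (∑ i, L i 0 * L i 1)^2) := by
    simp only [dotProduct_diagonal_mulVec, brkH_zero, brkH_one, brkH_two, Fin.sum_univ_three]
    ring
  rw [hfst, hsnd, h00, h11, h01, dotProduct_diagonal_mulVec]
  simp only [Matrix.mulVec_diagonal, Matrix.cons_val]
  field_simp
  ring

/-- The diagonal operator with eigenvalues `(t, t, 2t)` is a derivation of `heis₃`. -/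
lemma diagonal_derivation (t : ℝ) (x y : Fin 3 → ℝ) :
    (t • Matrix.diagonal ![1, 1, 2]).mulVec (brkH x y)
      = brkH ((t • Matrix.diagonal ![1, 1, 2]).mulVec x) y
        + brkH x ((t • Matrix.diagonal ![1, 1, 2]).mulVec y) := by
  ext k
  fin_cases k <;>
    simp [Matrix.smul_mulVec, Matrix.mulVec_diagonal, brkH]
  ring

/-- for `c ≥ 0`, `ρ > 0`, the metric Lie algebra `(heis₃, g_ρ^c)` is a
nilsoliton: with `K := 2ρ²(ρ+c)/(ρ+2c)³`, the Ricci endomorphism (transcribed through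
matrices in the basis `(e₀,f₀,Z)` as in the paper, with `L` an orthonormal basis, `H` the
mean curvature vector, `B` the Killing operator, `R` the curvature operator and `adHs`
the metric adjoint of `ad H`) satisfies `ric = -3K·id + D` with `D = 2K·δ`,
`δ = diag(1,1,2)` a derivation of `heis₃`; in particular there are `λ < 0` and a
derivation `D` of `heis₃` with `ric = λ·id + D`. -/
theorem statement12 (c ρ : ℝ) (hc : 0 ≤ c) (hρ : 0 < ρ)
    (L : Fin 3 → (Fin 3 → ℝ))
    (hL : ∀ i j, L i ⬝ᵥ (GramH c ρ).mulVec (L j) = if i = j then (1:ℝ) else 0)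
    (H : Fin 3 → ℝ)
    (hH : ∀ x, H ⬝ᵥ (GramH c ρ).mulVec x = (adH x).trace)
    (Bm : Matrix (Fin 3) (Fin 3) ℝ)
    (hB : ∀ x y, (Bm.mulVec x) ⬝ᵥ (GramH c ρ).mulVec y = (adH x * adH y).trace)
    (Rm : Matrix (Fin 3) (Fin 3) ℝ)
    (hR : ∀ x y, (Rm.mulVec x) ⬝ᵥ (GramH c ρ).mulVec y =
      -(1/2) * (∑ i, (brkH x (L i)) ⬝ᵥ (GramH c ρ).mulVec (brkH y (L i)))
      + (1/4) * (∑ i, ∑ j,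
          ((brkH (L i) (L j)) ⬝ᵥ (GramH c ρ).mulVec x)
            * ((brkH (L i) (L j)) ⬝ᵥ (GramH c ρ).mulVec y)))
    (adHs : Matrix (Fin 3) (Fin 3) ℝ)
    (hadHs : ∀ x y, ((adH H).mulVec x) ⬝ᵥ (GramH c ρ).mulVec y
      = x ⬝ᵥ (GramH c ρ).mulVec (adHs.mulVec y)) :
    (∀ x y : Fin 3 → ℝ,
      (Matrix.diagonal ![1,1,2]).mulVec (brkH x y)
        = brkH ((Matrix.diagonal ![1,1,2]).mulVec x) y
          + brkH x ((Matrix.diagonal ![1,1,2]).mulVec y)) ∧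
    Rm - (1/2 : ℝ) • Bm - (1/2 : ℝ) • (adH H + adHs)
      = (-3 * (2*ρ^2*(ρ+c)/(ρ+2*c)^3)) • (1 : Matrix (Fin 3) (Fin 3) ℝ)
        + (2 * (2*ρ^2*(ρ+c)/(ρ+2*c)^3)) • Matrix.diagonal ![1,1,2] ∧
    (∃ lam : ℝ, lam < 0 ∧ ∃ D : Matrix (Fin 3) (Fin 3) ℝ,
      (∀ x y : Fin 3 → ℝ,
        D.mulVec (brkH x y) = brkH (D.mulVec x) y + brkH x (D.mulVec y)) ∧
      Rm - (1/2 : ℝ) • Bm - (1/2 : ℝ) • (adH H + adHs)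
        = lam • (1 : Matrix (Fin 3) (Fin 3) ℝ) + D) := by
  have ha : 0 < (ρ+2*c)/(4*ρ^2) := by positivity
  have hb : 0 < (ρ+c)/(4*ρ^2*(ρ+2*c)) := by positivity
  have hH0 : H = 0 :=
    eq_zero_of_dotProduct_diagonal_mulVec ha hb fun x => (hH x).trans (trace_adH x)
  have hB0 : Bm = 0 := eq_of_mulVec_dotProduct_diagonal_mulVec ha hb fun x y => by
    rw [Matrix.zero_mulVec, zero_dotProduct]
    exact (hB x y).trans (trace_adH_mul_adH x y)
  have hs0 : adHs = 0 := eq_of_mulVec_dotProduct_diagonal_mulVec ha hb fun x y => by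
    rw [Matrix.zero_mulVec, zero_dotProduct, dotProduct_diagonal_mulVec]
    have h := hadHs y x
    rw [hH0, adH_zero, Matrix.zero_mulVec, zero_dotProduct, GramH,
      dotProduct_diagonal_mulVec] at h
    linarith
  have hR0 := eq_of_mulVec_dotProduct_diagonal_mulVec ha hb fun x y =>
    (hR x y).trans (curvature_form_eq ha hL x y)
  have hric : Rm - (1/2 : ℝ) • Bm - (1/2 : ℝ) • (adH H + adHs)
      = (-3 * (2*ρ^2*(ρ+c)/(ρ+2*c)^3)) • (1 : Matrix (Fin 3) (Fin 3) ℝ)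
        + (2 * (2*ρ^2*(ρ+c)/(ρ+2*c)^3)) • Matrix.diagonal ![1,1,2] := by
    have hK : (ρ+c)/(4*ρ^2*(ρ+2*c)) / (2 * ((ρ+2*c)/(4*ρ^2))^2)
        = 2*ρ^2*(ρ+c)/(ρ+2*c)^3 := by
      have : ρ + 2*c ≠ 0 := by positivity
      field_simp
      norm_num
    rw [hB0, hs0, hH0, adH_zero, hR0, hK]
    ext i j
    fin_cases i <;> fin_cases j <;> simp <;> ring
  refine ⟨fun x y => by simpa using diagonal_derivation 1 x y, hric, _, ?_, _,
    diagonal_derivation _, hric⟩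
  have : 0 < 2*ρ^2*(ρ+c)/(ρ+2*c)^3 := by positivity
  linarith
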